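/- For any normalized state ρ on registers S, L, E: H_min↑(S|LE)_ρ ≥ H_min↑(S|E)_ρ − I_max(L:SE)_ρ, where H_min↑(A|B)_ρ = −inf over normalized σ_B of D_∞(ρ_AB‖𝟙_A⊗σ_B) and I_max(L:SE)_ρ = D_∞(ρ_SLE‖ρ_L⊗ρ_SE). -/

import Mathlib

open scoped Kronecker
open Matrix
open scoped ComplexOrder

noncomputable section
namespace QITLeak

variable {A B : Type*}

/-- Real matrix power via spectral decomposition (Moore–Penrose pseudoinverse powers,
since `(0:ℝ) ^ (p:ℝ) = 0` for `p ≠ 0`). Junk value `0` on non-Hermitian input. -/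
noncomputable def mpow [Fintype A] [DecidableEq A] (ρ : Matrix A A ℂ) (p : ℝ) :
    Matrix A A ℂ :=
  if hρ : ρ.IsHermitian then
    (hρ.eigenvectorUnitary : Matrix A A ℂ) *
      Matrix.diagonal (fun i => ((hρ.eigenvalues i ^ p : ℝ) : ℂ)) *
      (star (hρ.eigenvectorUnitary : Matrix A A ℂ))
  else 0

/-- A normalized state (density matrix). -/
def IsState [Fintype A] (ρ : Matrix A A ℂ) : Prop := ρ.PosSemidef ∧ ρ.trace = 1

/-- A subnormalized state. -/
def IsSubState [Fintype A] (ρ : Matrix A A ℂ) : Prop := ρ.PosSemidef ∧ (ρ.trace).re ≤ 1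

/-- Partial trace over the second tensor factor. -/
def ptB [Fintype B] (ρ : Matrix (A × B) (A × B) ℂ) : Matrix A A ℂ :=
  Matrix.of fun a a' => ∑ b, ρ (a, b) (a', b)

/-- Partial trace over the first tensor factor. -/
def ptA [Fintype A] (ρ : Matrix (A × B) (A × B) ℂ) : Matrix B B ℂ :=
  Matrix.of fun b b' => ∑ a, ρ (a, b) (a, b')

/-- Partial trace over the factor `B`, along a decomposition `X ≃ A × B` of the registers. -/
def traceOut {X A B : Type*} [Fintype B] (e : X ≃ A × B) (ρ : Matrix X X ℂ) :
    Matrix A A ℂ :=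
  Matrix.of fun a a' => ∑ b, ρ (e.symm (a, b)) (e.symm (a', b))

/-- Support inclusion `supp ρ ⊆ supp σ` (for PSD matrices: kernel inclusion). -/
def suppSubset [Fintype A] (ρ σ : Matrix A A ℂ) : Prop :=
  ∀ v : A → ℂ, σ *ᵥ v = 0 → ρ *ᵥ v = 0

/-- The real-valued core formula of the sandwiched Rényi divergence (base 2). -/
def DR (α : ℝ) [Fintype A] [DecidableEq A] (ρ σ : Matrix A A ℂ) : ℝ :=
  (α - 1)⁻¹ * Real.logb 2
    (((mpow (mpow σ ((1 - α) / (2 * α)) * ρ * mpow σ ((1 - α) / (2 * α))) α).trace.re)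
      / (ρ.trace).re)

open scoped Classical in
/-- The sandwiched Rényi divergence `D_α(ρ‖σ)`, with value `⊤` outside the
support/orthogonality conditions. -/
def D (α : ℝ) [Fintype A] [DecidableEq A] (ρ σ : Matrix A A ℂ) : EReal :=
  if (α < 1 ∧ ¬ (ρ * σ = 0 ∧ σ * ρ = 0)) ∨ suppSubset ρ σ then ((DR α ρ σ : ℝ) : EReal)
  else ⊤

/-- The max-divergence `D_∞(ρ‖σ)`: log of the least `μ ≥ 0` with `ρ ≤ μσ` (`⊤` if none). -/
def Dmax [Fintype A] (ρ σ : Matrix A A ℂ) : EReal :=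
  sInf {x : EReal | ∃ μ : ℝ, 0 ≤ μ ∧ (μ • σ - ρ).PosSemidef ∧ x = ((Real.logb 2 μ : ℝ) : EReal)}

section Ent
variable [Fintype A] [DecidableEq A] [Fintype B] [DecidableEq B]

/-- `H_α↑(A|B)_ρ` for `ρ` on `A × B`. -/
def HUp (α : ℝ) (ρ : Matrix (A × B) (A × B) ℂ) : EReal :=
  - sInf {x : EReal | ∃ σ : Matrix B B ℂ, IsState σ ∧ x = D α ρ ((1 : Matrix A A ℂ) ⊗ₖ σ)}

/-- `H_α(A|B)_ρ` for `ρ` on `A × B`. -/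
def Hdn (α : ℝ) (ρ : Matrix (A × B) (A × B) ℂ) : EReal :=
  - D α ρ ((1 : Matrix A A ℂ) ⊗ₖ ptA ρ)

/-- `I_α↓(A;B)_ρ` for `ρ` on `A × B`. -/
def Idown (α : ℝ) (ρ : Matrix (A × B) (A × B) ℂ) : EReal :=
  sInf {x : EReal | ∃ σ : Matrix B B ℂ, IsState σ ∧ x = D α ρ ((ptB ρ) ⊗ₖ σ)}

/-- `I_α(A:B)_ρ` for `ρ` on `A × B`. -/
def Imut (α : ℝ) (ρ : Matrix (A × B) (A × B) ℂ) : EReal :=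
  D α ρ ((ptB ρ) ⊗ₖ (ptA ρ))

/-- `I_α↓↓(A:B)_ρ` for `ρ` on `A × B`. -/
def Idd (α : ℝ) (ρ : Matrix (A × B) (A × B) ℂ) : EReal :=
  sInf {x : EReal | ∃ (ω : Matrix A A ℂ) (σ : Matrix B B ℂ),
    IsState ω ∧ IsState σ ∧ x = D α ρ (ω ⊗ₖ σ)}

/-- `H_min↑(A|B)_ρ = H_∞↑(A|B)_ρ`. -/
def HminUp (ρ : Matrix (A × B) (A × B) ℂ) : EReal :=
  - sInf {x : EReal | ∃ σ : Matrix B B ℂ, IsState σ ∧ x = Dmax ρ ((1 : Matrix A A ℂ) ⊗ₖ σ)}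

/-- `I_∞↓(A;B)_ρ`. -/
def ImaxD (ρ : Matrix (A × B) (A × B) ℂ) : EReal :=
  sInf {x : EReal | ∃ σ : Matrix B B ℂ, IsState σ ∧ x = Dmax ρ ((ptB ρ) ⊗ₖ σ)}

/-- `I_∞(A:B)_ρ` (unoptimized max-information). -/
def ImaxND (ρ : Matrix (A × B) (A × B) ℂ) : EReal :=
  Dmax ρ ((ptB ρ) ⊗ₖ (ptA ρ))

/-- `I_∞↓↓(A:B)_ρ`. -/
def IddMax (ρ : Matrix (A × B) (A × B) ℂ) : EReal :=
  sInf {x : EReal | ∃ (ω : Matrix A A ℂ) (σ : Matrix B B ℂ),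
    IsState ω ∧ IsState σ ∧ x = Dmax ρ (ω ⊗ₖ σ)}

end Ent

/-- Trace norm. -/
def traceNorm [Fintype A] [DecidableEq A] (M : Matrix A A ℂ) : ℝ :=
  (mpow (Mᴴ * M) (1 / 2 : ℝ)).trace.re

/-- Generalized fidelity of subnormalized states. -/
def gFid [Fintype A] [DecidableEq A] (ρ σ : Matrix A A ℂ) : ℝ :=
  traceNorm (mpow ρ (1 / 2 : ℝ) * mpow σ (1 / 2 : ℝ)) +
    Real.sqrt ((1 - ρ.trace.re) * (1 - σ.trace.re))

/-- Purified distance. -/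
def pDist [Fintype A] [DecidableEq A] (ρ σ : Matrix A A ℂ) : ℝ :=
  Real.sqrt (1 - gFid ρ σ ^ 2)

section Smooth
variable [Fintype A] [DecidableEq A] [Fintype B] [DecidableEq B]

/-- Smoothed min-entropy `H_min↑,ε(A|B)_ρ`. -/
def HminUpEps (ε : ℝ) (ρ : Matrix (A × B) (A × B) ℂ) : EReal :=
  sSup {x : EReal | ∃ ρ' : Matrix (A × B) (A × B) ℂ,
    IsSubState ρ' ∧ pDist ρ' ρ ≤ ε ∧ x = HminUp ρ'}

/-- Smoothed max-information `I_max↓,ε(A;B)_ρ`. -/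
def ImaxDEps (ε : ℝ) (ρ : Matrix (A × B) (A × B) ℂ) : EReal :=
  sInf {x : EReal | ∃ ρ' : Matrix (A × B) (A × B) ℂ,
    IsSubState ρ' ∧ pDist ρ' ρ ≤ ε ∧ x = ImaxD ρ'}

/-- Smoothed (unoptimized) max-information `I_max^ε(A:B)_ρ`. -/
def ImaxNDEps (ε : ℝ) (ρ : Matrix (A × B) (A × B) ℂ) : EReal :=
  sInf {x : EReal | ∃ ρ' : Matrix (A × B) (A × B) ℂ,
    IsSubState ρ' ∧ pDist ρ' ρ ≤ ε ∧ x = ImaxND ρ'}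

/-- Smoothed max-information `I_max↓↓,ε(A:B)_ρ`. -/
def IddMaxEps (ε : ℝ) (ρ : Matrix (A × B) (A × B) ℂ) : EReal :=
  sInf {x : EReal | ∃ ρ' : Matrix (A × B) (A × B) ℂ,
    IsSubState ρ' ∧ pDist ρ' ρ ≤ ε ∧ x = IddMax ρ'}

/-- Smoothed Rényi conditional entropy `H_α↑,ε(A|B)_ρ`. -/
def HUpEps (α ε : ℝ) (ρ : Matrix (A × B) (A × B) ℂ) : EReal :=
  sSup {x : EReal | ∃ ρ' : Matrix (A × B) (A × B) ℂ,
    IsSubState ρ' ∧ pDist ρ' ρ ≤ ε ∧ x = HUp α ρ'}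

end Smooth

/-- Extension `id_R ⊗ Φ` of a linear map on matrices, with a spectator register on the left. -/
def lext {R A B : Type*} (Φ : Matrix A A ℂ →ₗ[ℂ] Matrix B B ℂ) :
    Matrix (R × A) (R × A) ℂ →ₗ[ℂ] Matrix (R × B) (R × B) ℂ where
  toFun ρ := Matrix.of fun p q => Φ (Matrix.of fun a a' => ρ (p.1, a) (q.1, a')) p.2 q.2
  map_add' x y := by
    ext p q
    show Φ ((Matrix.of fun a a' => x (p.1, a) (q.1, a'))
        + (Matrix.of fun a a' => y (p.1, a) (q.1, a'))) p.2 q.2 = _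
    rw [map_add]; rfl
  map_smul' c x := by
    ext p q
    show Φ (c • (Matrix.of fun a a' => x (p.1, a) (q.1, a'))) p.2 q.2 = _
    rw [_root_.map_smul]; rfl

/-- Extension `Φ ⊗ id_R` of a linear map on matrices, with a spectator register on the right. -/
def rext {A B R : Type*} (Φ : Matrix A A ℂ →ₗ[ℂ] Matrix B B ℂ) :
    Matrix (A × R) (A × R) ℂ →ₗ[ℂ] Matrix (B × R) (B × R) ℂ where
  toFun ρ := Matrix.of fun p q => Φ (Matrix.of fun a a' => ρ (a, p.2) (a', q.2)) p.1 q.1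
  map_add' x y := by
    ext p q
    show Φ ((Matrix.of fun a a' => x (a, p.2) (a', q.2))
        + (Matrix.of fun a a' => y (a, p.2) (a', q.2))) p.1 q.1 = _
    rw [map_add]; rfl
  map_smul' c x := by
    ext p q
    show Φ (c • (Matrix.of fun a a' => x (a, p.2) (a', q.2))) p.1 q.1 = _
    rw [_root_.map_smul]; rfl

/-- Completely positive trace-preserving map (quantum channel). -/
structure IsCPTP {A B : Type*} [Fintype A] [Fintype B]
    (Φ : Matrix A A ℂ →ₗ[ℂ] Matrix B B ℂ) : Prop where
  cp : ∀ (n : ℕ) (ρ : Matrix (Fin n × A) (Fin n × A) ℂ), ρ.PosSemidef →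
    ((lext Φ) ρ).PosSemidef
  tp : ∀ ρ : Matrix A A ℂ, (Φ ρ).trace = ρ.trace

/-- The rank-one (pure) state associated to a vector. -/
def pureState {A : Type*} (ψ : A → ℂ) : Matrix A A ℂ := Matrix.vecMulVec ψ (star ψ)


/-! ## Statement 2
For any normalized state ρ on registers S, L, E:
`H_min↑(S|LE)_ρ ≥ H_min↑(S|E)_ρ − I_max(L:SE)_ρ`. -/

/-- Register shuffle `S × (L × E) ≃ (S × E) × L` (trace out `L` / group `SE`). -/
def eSEL (S L E : Type*) : S × (L × E) ≃ (S × E) × L where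
  toFun x := ((x.1, x.2.2), x.2.1)
  invFun y := (y.1.1, (y.2, y.1.2))
  left_inv _ := rfl
  right_inv _ := rfl

/-- Register shuffle `S × (L × E) ≃ L × (S × E)`. -/
def eLSE (S L E : Type*) : S × (L × E) ≃ L × (S × E) where
  toFun x := (x.2.1, (x.1, x.2.2))
  invFun y := (y.2.1, (y.1, y.2.2))
  left_inv _ := rfl
  right_inv _ := rfl

lemma posSemidef_ptB [Fintype A] [Fintype B] {ρ : Matrix (A × B) (A × B) ℂ}
    (hρ : ρ.PosSemidef) : (ptB ρ).PosSemidef := by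
  have h : ptB ρ = ∑ b, ρ.submatrix (fun a => (a, b)) (fun a => (a, b)) := by
    ext a a'
    simp [ptB, Matrix.sum_apply]
  rw [h]
  exact Matrix.posSemidef_sum _ fun b _ => hρ.submatrix _

lemma trace_ptB [Fintype A] [Fintype B] (ρ : Matrix (A × B) (A × B) ℂ) :
    (ptB ρ).trace = ρ.trace := by
  simp [ptB, Matrix.trace, Fintype.sum_prod_type]

lemma trace_traceOut {X : Type*} [Fintype X] [Fintype A] [Fintype B] (e : X ≃ A × B)
    (ρ : Matrix X X ℂ) : (traceOut e ρ).trace = ρ.trace := by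
  simp only [traceOut, Matrix.trace, Matrix.diag, Matrix.of_apply]
  rw [← Fintype.sum_prod_type (fun y : A × B => ρ (e.symm y) (e.symm y))]
  exact e.symm.sum_comp fun x => ρ x x

lemma IsState.ptB [Fintype A] [Fintype B] {ρ : Matrix (A × B) (A × B) ℂ} (hρ : IsState ρ) :
    IsState (ptB ρ) :=
  ⟨posSemidef_ptB hρ.1, (trace_ptB ρ).trans hρ.2⟩

lemma IsState.reindex {X Y : Type*} [Fintype X] [Fintype Y] (e : X ≃ Y) {ρ : Matrix X X ℂ}
    (hρ : IsState ρ) : IsState (Matrix.reindex e e ρ) := by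
  refine ⟨hρ.1.submatrix _, ?_⟩
  rw [← hρ.2]
  exact e.symm.sum_comp fun x => ρ x x

lemma IsState.kronecker [Fintype A] [Fintype B] {ρ : Matrix A A ℂ} {σ : Matrix B B ℂ}
    (hρ : IsState ρ) (hσ : IsState σ) : IsState (ρ ⊗ₖ σ) :=
  ⟨hρ.1.kronecker hσ.1, by rw [Matrix.trace_kronecker, hρ.2, hσ.2, one_mul]⟩

/-- The reduced state `ρ_SE` does not depend on the shuffle used to reach it. -/
lemma ptA_reindex_eLSE {S L E : Type*} [Fintype L]
    (ρ : Matrix (S × (L × E)) (S × (L × E)) ℂ) :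
    ptA (Matrix.reindex (eLSE S L E) (eLSE S L E) ρ) = traceOut (eSEL S L E) ρ := rfl

lemma pos_of_smul_sub_posSemidef [Fintype A] {ρ σ : Matrix A A ℂ} (hρ : ρ.trace = 1) {μ : ℝ}
    (hμ : 0 ≤ μ) (h : (μ • σ - ρ).PosSemidef) : 0 < μ := by
  refine hμ.lt_of_ne ?_
  rintro rfl
  have ht := h.trace_nonneg
  rw [zero_smul, zero_sub, Matrix.trace_neg, hρ] at ht
  have := (Complex.le_def.mp ht).1
  norm_num at this

lemma Dmax_le [Fintype A] {ρ σ : Matrix A A ℂ} {μ : ℝ} (hμ : 0 ≤ μ)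
    (h : (μ • σ - ρ).PosSemidef) : Dmax ρ σ ≤ ((Real.logb 2 μ : ℝ) : EReal) :=
  sInf_le ⟨μ, hμ, h, rfl⟩

lemma exists_logb_lt_of_Dmax_lt [Fintype A] {ρ σ : Matrix A A ℂ} {c : EReal}
    (h : Dmax ρ σ < c) :
    ∃ μ : ℝ, 0 ≤ μ ∧ (μ • σ - ρ).PosSemidef ∧ ((Real.logb 2 μ : ℝ) : EReal) < c := by
  obtain ⟨_, ⟨μ, hμ, hpsd, rfl⟩, hlt⟩ := sInf_lt_iff.mp h
  exact ⟨μ, hμ, hpsd, hlt⟩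

/-- Operator inequalities `ρ_SE ≤ μ 1 ⊗ σ_E` and `ρ_LSE ≤ ν ω_L ⊗ ρ_SE` compose to
`ρ_SLE ≤ ν μ 1 ⊗ (ω_L ⊗ σ_E)`. -/
lemma posSemidef_smul_one_kronecker_sub {S L E : Type*} [Fintype S] [DecidableEq S] [Fintype L]
    [Fintype E] {ρ : Matrix (S × (L × E)) (S × (L × E)) ℂ} {τ : Matrix (S × E) (S × E) ℂ}
    {ω : Matrix L L ℂ} {σ : Matrix E E ℂ} {μ ν : ℝ} (hν : 0 ≤ ν) (hω : ω.PosSemidef)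
    (hμτ : (μ • ((1 : Matrix S S ℂ) ⊗ₖ σ) - τ).PosSemidef)
    (hνρ : (ν • (ω ⊗ₖ τ) - Matrix.reindex (eLSE S L E) (eLSE S L E) ρ).PosSemidef) :
    ((ν * μ) • ((1 : Matrix S S ℂ) ⊗ₖ (ω ⊗ₖ σ)) - ρ).PosSemidef := by
  have h : (ν * μ) • ((1 : Matrix S S ℂ) ⊗ₖ (ω ⊗ₖ σ)) - ρ =
      (ν • (ω ⊗ₖ (μ • ((1 : Matrix S S ℂ) ⊗ₖ σ) - τ)) +
        (ν • (ω ⊗ₖ τ) - Matrix.reindex (eLSE S L E) (eLSE S L E) ρ)).submatrix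
          (eLSE S L E) (eLSE S L E) := by
    ext ⟨s, l, e⟩ ⟨s', l', e'⟩
    simp [eLSE]
    ring
  rw [h]
  exact (((hω.kronecker hμτ).smul hν).add hνρ).submatrix _

lemma neg_logb_le_HminUp [Fintype A] [DecidableEq A] [Fintype B] [DecidableEq B]
    {ρ : Matrix (A × B) (A × B) ℂ} {σ : Matrix B B ℂ} (hσ : IsState σ) {μ : ℝ} (hμ : 0 ≤ μ)
    (h : (μ • ((1 : Matrix A A ℂ) ⊗ₖ σ) - ρ).PosSemidef) :
    -((Real.logb 2 μ : ℝ) : EReal) ≤ HminUp ρ :=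
  EReal.neg_le_neg_iff.mpr <| sInf_le_of_le ⟨σ, hσ, rfl⟩ (Dmax_le hμ h)

theorem hmin_chain_rule_nonsmoothed
    {S L E : Type*} [Fintype S] [DecidableEq S] [Fintype L] [DecidableEq L]
    [Fintype E] [DecidableEq E]
    (ρ : Matrix (S × (L × E)) (S × (L × E)) ℂ) (hρ : IsState ρ) :
    HminUp ρ ≥
      HminUp (traceOut (eSEL S L E) ρ)
        - ImaxND ((Matrix.reindex (eLSE S L E) (eLSE S L E)) ρ) := by
  have hω : IsState (ptB (Matrix.reindex (eLSE S L E) (eLSE S L E) ρ)) := (hρ.reindex _).ptB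
  refine EReal.add_le_of_forall_lt fun a ha b hb => ?_
  obtain ⟨_, ⟨σ, hσ, rfl⟩, hσa⟩ := sInf_lt_iff.mp (EReal.lt_neg_comm.mp ha)
  obtain ⟨μ, hμ, hμpsd, hμa⟩ := exists_logb_lt_of_Dmax_lt hσa
  obtain ⟨ν, hν, hνpsd, hνb⟩ := exists_logb_lt_of_Dmax_lt (EReal.lt_neg_comm.mp hb)
  rw [ptA_reindex_eLSE] at hνpsd
  have hμ0 := pos_of_smul_sub_posSemidef ((trace_traceOut _ ρ).trans hρ.2) hμ hμpsd
  have hν0 := pos_of_smul_sub_posSemidef (hρ.reindex _).2 hν hνpsd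
  calc a + b ≤ ((-Real.logb 2 μ : ℝ) : EReal) + ((-Real.logb 2 ν : ℝ) : EReal) := by
        push_cast
        exact add_le_add (EReal.lt_neg_comm.mp hμa).le (EReal.lt_neg_comm.mp hνb).le
    _ = -((Real.logb 2 (ν * μ) : ℝ) : EReal) := by
        rw [Real.logb_mul hν0.ne' hμ0.ne']
        norm_cast
        ring
    _ ≤ HminUp ρ := neg_logb_le_HminUp (hω.kronecker hσ) (mul_nonneg hν hμ)
        (posSemidef_smul_one_kronecker_sub hν hω.1 hμpsd hνpsd)


end QITLeak
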